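/- Absorption lemma for F-factors: Let k ≥ 2, let t and i be positive integers, let η > 0, and let F be a k-graph on t vertices. Then there exists an integer n₀ (depending only on k, t, i, η) such that the following holds. If H is a k-graph on n ≥ n₀ vertices which is (F, i, η)-closed, then there exists a vertex subset U ⊆ V(H) with |U| ≤ (η/2)^t · n/4 such that for every vertex set W ⊆ V(H) \ U with |W| ≤ (η/2)^{2t} · t · n/32 and |W| divisible by t, the induced subhypergraph H[U ∪ W] contains an F-factor. -/

import Mathlib

open Finset

/-- `A` is the vertex set of a copy of the hypergraph with vertex type `V` and edge set `EF`
inside the hypergraph on `Fin n` with edge set `E`. -/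
def IsCopy {n : ℕ} {V : Type} [Fintype V] [DecidableEq V] (E : Finset (Finset (Fin n)))
    (EF : Finset (Finset V)) (A : Finset (Fin n)) : Prop :=
  ∃ f : V ↪ Fin n, Finset.map f Finset.univ = A ∧ ∀ e ∈ EF, e.map f ∈ E

/-- The induced subhypergraph of `E` on `S` has an `F`-factor, where `F` has vertex type `V`
and edge set `EF`: there are pairwise vertex-disjoint copies of `F` covering exactly `S`. -/
def HasFactorOn {n : ℕ} {V : Type} [Fintype V] [DecidableEq V] (E : Finset (Finset (Fin n)))
    (EF : Finset (Finset V)) (S : Finset (Fin n)) : Prop :=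
  ∃ P : Finset (Finset (Fin n)), (∀ A ∈ P, IsCopy E EF A) ∧
    (P : Set (Finset (Fin n))).PairwiseDisjoint id ∧ P.biUnion id = S

/-- `x` is `(F, i, η)`-close to `y`. -/
def CloseTo {n : ℕ} {V : Type} [Fintype V] [DecidableEq V] (E : Finset (Finset (Fin n)))
    (EF : Finset (Finset V)) (i : ℕ) (η : ℝ) (x y : Fin n) : Prop :=
  η * (n : ℝ) ^ (i * Fintype.card V - 1) ≤
    (({S : Finset (Fin n) | S.card = i * Fintype.card V - 1 ∧ x ∉ S ∧ y ∉ S ∧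
      HasFactorOn E EF (insert x S) ∧ HasFactorOn E EF (insert y S)}).ncard : ℝ)

/-- `H` is `(F, i, η)`-closed. -/
def IsClosedGraph {n : ℕ} {V : Type} [Fintype V] [DecidableEq V] (E : Finset (Finset (Fin n)))
    (EF : Finset (Finset V)) (i : ℕ) (η : ℝ) : Prop :=
  ∀ x y : Fin n, x ≠ y → CloseTo E EF i η x y

/-- `Ñ_{F,i,η}(x)`: the set of vertices `(F, i, η)`-close to `x`. -/
def Ntilde {n : ℕ} {V : Type} [Fintype V] [DecidableEq V] (E : Finset (Finset (Fin n)))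
    (EF : Finset (Finset V)) (i : ℕ) (η : ℝ) (x : Fin n) : Set (Fin n) :=
  {y | CloseTo E EF i η x y}

/-- Degree of the set `T` in the `k`-graph with edge set `E`. -/
noncomputable def degOn {n : ℕ} (E : Finset (Finset (Fin n))) (k : ℕ) (T : Finset (Fin n)) : ℕ :=
  ({S : Finset (Fin n) | S.card = k - T.card ∧ Disjoint S T ∧ S ∪ T ∈ E}).ncard

/-- Edge set of the complete `k`-graph `K_t^k` on `Fin t`. -/
def cliqueEdges (t k : ℕ) : Finset (Finset (Fin t)) :=
  Finset.powersetCard k (Finset.univ : Finset (Fin t))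

/-- Edge set of the complete `k`-partite `k`-graph `K_k^k(m)` with parts of size `m`. -/
def multipartiteEdges (k m : ℕ) : Finset (Finset (Fin k × Fin m)) :=
  Finset.univ.filter (fun e : Finset (Fin k × Fin m) =>
    ∀ i : Fin k, (e.filter (fun v => v.1 = i)).card = 1)

theorem IsCopy.card_eq {n : ℕ} {V : Type} [Fintype V] [DecidableEq V]
    {E : Finset (Finset (Fin n))} {EF : Finset (Finset V)} {A : Finset (Fin n)}
    (h : IsCopy E EF A) : A.card = Fintype.card V := by
  obtain ⟨f, rfl, -⟩ := h
  simp

theorem IsCopy.hasFactorOn {n : ℕ} {V : Type} [Fintype V] [DecidableEq V]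
    {E : Finset (Finset (Fin n))} {EF : Finset (Finset V)} {A : Finset (Fin n)}
    (h : IsCopy E EF A) : HasFactorOn E EF A :=
  ⟨{A}, by simpa using h, by simp, by simp⟩

theorem hasFactorOn_empty {n : ℕ} {V : Type} [Fintype V] [DecidableEq V]
    (E : Finset (Finset (Fin n))) (EF : Finset (Finset V)) : HasFactorOn E EF ∅ :=
  ⟨∅, by simp, by simp, by simp⟩

theorem HasFactorOn.union {n : ℕ} {V : Type} [Fintype V] [DecidableEq V]
    {E : Finset (Finset (Fin n))} {EF : Finset (Finset V)} {S S' : Finset (Fin n)}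
    (h : HasFactorOn E EF S) (h' : HasFactorOn E EF S') (hd : Disjoint S S') :
    HasFactorOn E EF (S ∪ S') := by
  obtain ⟨P, hP, hPd, rfl⟩ := h
  obtain ⟨P', hP', hPd', rfl⟩ := h'
  refine ⟨P ∪ P', fun A hA => (mem_union.1 hA).elim (hP A) (hP' A), ?_, by
    rw [union_biUnion]⟩
  rw [coe_union, Set.pairwiseDisjoint_union]
  exact ⟨hPd, hPd', fun A hA B hB _ =>
    hd.mono (subset_biUnion_of_mem id hA) (subset_biUnion_of_mem id hB)⟩

theorem hasFactorOn_biUnion {n : ℕ} {V ι : Type} [Fintype V] [DecidableEq V]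
    {E : Finset (Finset (Fin n))} {EF : Finset (Finset V)} (s : Finset ι)
    (f : ι → Finset (Fin n)) (hd : (s : Set ι).PairwiseDisjoint f)
    (hf : ∀ a ∈ s, HasFactorOn E EF (f a)) : HasFactorOn E EF (s.biUnion f) := by
  classical
  induction s using Finset.induction_on with
  | empty => simpa using hasFactorOn_empty E EF
  | insert a s ha ih =>
    rw [biUnion_insert]
    rw [coe_insert] at hd
    refine (hf a (mem_insert_self a s)).union
      (ih (hd.subset (Set.subset_insert _ _)) fun b hb => hf b (mem_insert_of_mem hb)) ?_
    rw [disjoint_biUnion_right]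
    exact fun b hb => hd (Set.mem_insert _ _) (Set.mem_insert_of_mem _ hb)
      fun hab => ha (hab ▸ hb)

/-- `A` can absorb `T`: both `A` and `A ∪ T` have a factor. -/
def IsAbsorber {n : ℕ} {V : Type} [Fintype V] [DecidableEq V] (E : Finset (Finset (Fin n)))
    (EF : Finset (Finset V)) (T A : Finset (Fin n)) : Prop :=
  HasFactorOn E EF A ∧ HasFactorOn E EF (A ∪ T)

open Classical in
/-- A family of disjoint sets in which every `t`-set has at least `r` absorbers absorbs every
set of `r * t` further vertices. -/
theorem hasFactorOn_biUnion_union {n : ℕ} {V : Type} [Fintype V] [DecidableEq V]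
    {E : Finset (Finset (Fin n))} {EF : Finset (Finset V)} {t : ℕ} (r : ℕ)
    (G : Finset (Finset (Fin n))) (W : Finset (Fin n))
    (hG : (G : Set (Finset (Fin n))).PairwiseDisjoint id) (hf : ∀ A ∈ G, HasFactorOn E EF A)
    (hW : Disjoint W (G.biUnion id)) (hcard : W.card = r * t)
    (habs : ∀ T : Finset (Fin n), T.card = t → r ≤ (G.filter (IsAbsorber E EF T)).card) :
    HasFactorOn E EF (G.biUnion id ∪ W) := by
  induction r generalizing G W with
  | zero =>
    obtain rfl : W = ∅ := by simpa using hcard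
    simpa using hasFactorOn_biUnion G id hG hf
  | succ r ih =>
    obtain ⟨T, hTW, hT⟩ := exists_subset_card_eq (s := W) (n := t) (by rw [hcard]; nlinarith)
    obtain ⟨A, hA⟩ := card_pos.1 (lt_of_lt_of_le (Nat.succ_pos r) (habs T hT))
    obtain ⟨hAG, -, hAT⟩ := mem_filter.1 hA
    have hsub : (G.erase A).biUnion id ⊆ G.biUnion id :=
      biUnion_subset_biUnion_of_subset_left _ (erase_subset _ _)
    have key := ih (G.erase A) (W \ T) (hG.subset (by simp)) (fun B hB => hf B (mem_of_mem_erase hB))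
      (hW.mono sdiff_subset hsub)
      (by rw [card_sdiff_of_subset hTW, hcard, hT, Nat.succ_mul, Nat.add_sub_cancel])
      (fun T' hT' => by
        have h1 := habs T' hT'
        rw [filter_erase]
        have h2 := pred_card_le_card_erase (s := G.filter (IsAbsorber E EF T')) (a := A)
        omega)
    have hAW : Disjoint W A := hW.mono_right (subset_biUnion_of_mem id hAG)
    have hAe : Disjoint A ((G.erase A).biUnion id) := by
      rw [disjoint_biUnion_right]
      exact fun B hB => hG hAG (mem_of_mem_erase hB) (ne_of_mem_erase hB).symm
    have hTe : Disjoint T ((G.erase A).biUnion id) := hW.mono hTW hsub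
    have := hAT.union key (by
      rw [disjoint_union_left, disjoint_union_right, disjoint_union_right]
      exact ⟨⟨hAe, hAW.symm.mono_right sdiff_subset⟩, hTe, disjoint_sdiff⟩)
    convert this using 1
    conv_lhs => rw [← insert_erase hAG, biUnion_insert, ← union_sdiff_of_subset hTW]
    simp only [id]
    ac_rfl

theorem mul_le_card_of_injOn {α β γ : Type} {A : Finset α} {B : α → Finset β} {C : Finset γ}
    (f : α → β → γ) {c d : ℝ} (hd : 0 ≤ d) (hA : c ≤ A.card)
    (hB : ∀ a ∈ A, d ≤ (B a).card) (hC : ∀ a ∈ A, ∀ b ∈ B a, f a b ∈ C)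
    (hf : ∀ a a' b b', f a b = f a' b' → a = a' ∧ b = b') : c * d ≤ C.card := by
  have h1 : (A.sigma B).card ≤ C.card := by
    refine card_le_card_of_injOn (fun x => f x.1 x.2) ?_ ?_
    · rintro ⟨a, b⟩ h
      obtain ⟨ha, hb⟩ := mem_sigma.1 (mem_coe.1 h)
      exact hC a ha b hb
    · rintro ⟨a, b⟩ - ⟨a', b'⟩ - h
      obtain ⟨rfl, rfl⟩ := hf _ _ _ _ h
      rfl
  calc c * d ≤ A.card * d := by gcongr
    _ = ∑ _a ∈ A, d := by simp
    _ ≤ ∑ a ∈ A, ((B a).card : ℝ) := sum_le_sum hB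
    _ = (A.sigma B).card := by simp
    _ ≤ C.card := by exact_mod_cast h1

theorem card_powersetCard_fin_le (n b : ℕ) :
    (powersetCard b (univ : Finset (Fin n))).card ≤ n ^ b := by
  rw [card_powersetCard, card_fin]
  exact Nat.choose_le_pow n b

/-- At least half of a dense family of `b`-sets avoids a small set. -/
theorem half_le_card_filter_disjoint {n b : ℕ} {η : ℝ} (hb : 1 ≤ b)
    (F : Finset (Finset (Fin n))) (hF : ∀ S ∈ F, S.card = b) (hcard : η * n ^ b ≤ F.card)
    (Z : Finset (Fin n)) (hZ : (Z.card : ℝ) ≤ η / 2 * n) :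
    η / 2 * n ^ b ≤ (F.filter (Disjoint · Z)).card := by
  obtain ⟨b, rfl⟩ := Nat.exists_eq_add_of_le' hb
  have h1 : (F.filter (¬ Disjoint · Z)).card ≤ Z.card * n ^ b := by
    calc (F.filter (¬ Disjoint · Z)).card
        ≤ ((Z ×ˢ powersetCard b univ).image fun q => insert q.1 q.2).card := by
          refine card_le_card fun S hS => ?_
          obtain ⟨hS, hd⟩ := mem_filter.1 hS
          obtain ⟨z, hzS, hz⟩ := not_disjoint_iff.1 hd
          refine mem_image.2 ⟨(z, S.erase z), ?_, insert_erase hzS⟩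
          simp [hz, card_erase_of_mem hzS, hF S hS]
      _ ≤ Z.card * (powersetCard b (univ : Finset (Fin n))).card := by
          rw [← card_product]; exact card_image_le
      _ ≤ Z.card * n ^ b := Nat.mul_le_mul_left _ (card_powersetCard_fin_le n b)
  have h2 := card_filter_add_card_filter_not (s := F) (Disjoint · Z)
  have h1' : ((F.filter (¬ Disjoint · Z)).card : ℝ) ≤ η / 2 * n * n ^ b :=
    le_trans (by exact_mod_cast h1) (mul_le_mul_of_nonneg_right hZ (by positivity))
  have h2' : ((F.filter (Disjoint · Z)).card : ℝ) + (F.filter (¬ Disjoint · Z)).card = F.card := by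
    exact_mod_cast h2
  rw [pow_succ] at *
  linarith

open Classical in
/-- Dense families of `b`-sets contain many systems of disjoint representatives. -/
theorem pow_le_card_disjoint_systems {n b r : ℕ} {η : ℝ} (hη : 0 ≤ η) (hb : 1 ≤ b)
    (F : Fin r → Finset (Finset (Fin n))) (hF : ∀ j, ∀ S ∈ F j, S.card = b)
    (hcard : ∀ j, η * n ^ b ≤ (F j).card) (Z : Finset (Fin n))
    (hZ : (Z.card : ℝ) + r * b ≤ η / 2 * n) :
    (η / 2 * n ^ b) ^ r ≤ ((Fintype.piFinset F).filter fun S =>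
      (∀ j, Disjoint (S j) Z) ∧ Pairwise fun j l => Disjoint (S j) (S l)).card := by
  induction r generalizing Z with
  | zero =>
    simp only [pow_zero, Nat.one_le_cast]
    refine card_pos.2 ⟨fun j => j.elim0, ?_⟩
    simp [Pairwise, eq_iff_true_of_subsingleton]
  | succ r ih =>
    push_cast at hZ
    have hrb : (0 : ℝ) ≤ r * b := by positivity
    rw [pow_succ']
    refine mul_le_card_of_injOn (A := (F 0).filter (Disjoint · Z))
      (B := fun S₀ => (Fintype.piFinset fun j : Fin r => F j.succ).filter fun S =>
        (∀ j, Disjoint (S j) (Z ∪ S₀)) ∧ Pairwise fun j l => Disjoint (S j) (S l))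
      (fun S₀ S => Fin.cons S₀ S) (by positivity)
      (half_le_card_filter_disjoint hb _ (hF 0) (hcard 0) Z (by nlinarith)) ?_ ?_ ?_
    · intro S₀ hS₀
      have h0 := hF 0 S₀ (mem_filter.1 hS₀).1
      refine ih (fun j => F j.succ) (fun j => hF _) (fun j => hcard _) _ ?_
      have : ((Z ∪ S₀).card : ℝ) ≤ Z.card + b := by
        rw [← h0]; exact_mod_cast card_union_le _ _
      linarith
    · intro S₀ hS₀ S hS
      simp only [mem_filter, Fintype.mem_piFinset, disjoint_union_right] at hS hS₀ ⊢
      refine ⟨Fin.cases hS₀.1 hS.1, Fin.cases hS₀.2 fun j => (hS.2.1 j).1, ?_⟩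
      intro j l
      refine Fin.cases ?_ (fun j => ?_) j <;> refine Fin.cases ?_ (fun l => ?_) l
      · simp
      · exact fun _ => (hS.2.1 l).2.symm
      · exact fun _ => (hS.2.1 j).2
      · exact fun h => hS.2.2 fun h' => h (congrArg Fin.succ h')
    · intro a a' S S' h
      exact Fin.cons_inj.1 h

open Classical in
theorem CloseTo.le_card {n : ℕ} {V : Type} [Fintype V] [DecidableEq V]
    {E : Finset (Finset (Fin n))} {EF : Finset (Finset V)} {i : ℕ} {η : ℝ} {x y : Fin n}
    (h : CloseTo E EF i η x y) :
    η * n ^ (i * Fintype.card V - 1) ≤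
      (univ.filter fun S : Finset (Fin n) => S.card = i * Fintype.card V - 1 ∧ x ∉ S ∧ y ∉ S ∧
        HasFactorOn E EF (insert x S) ∧ HasFactorOn E EF (insert y S)).card := by
  unfold CloseTo at h
  rwa [Set.ncard_eq_toFinset_card', Set.toFinset_ofPred] at h

theorem CloseTo.le_one {n : ℕ} {V : Type} [Fintype V] [DecidableEq V]
    {E : Finset (Finset (Fin n))} {EF : Finset (Finset V)} {i : ℕ} {η : ℝ} {x y : Fin n}
    (h : CloseTo E EF i η x y) : η ≤ 1 := by
  classical
  have hn : 0 < n := x.pos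
  refine le_of_mul_le_mul_right (h.le_card.trans ?_)
    (show (0 : ℝ) < (n : ℝ) ^ (i * Fintype.card V - 1) by positivity)
  rw [one_mul]
  refine le_trans (Nat.cast_le.2 (card_le_card fun S hS => ?_))
    (by exact_mod_cast card_powersetCard_fin_le n (i * Fintype.card V - 1))
  exact mem_powersetCard.2 ⟨subset_univ S, (mem_filter.1 hS).2.1⟩

open Classical in
/-- A vertex close to some other vertex lies in many copies of `F`. -/
theorem CloseTo.le_card_isCopy {n : ℕ} {V : Type} [Fintype V] [DecidableEq V]
    {E : Finset (Finset (Fin n))} {EF : Finset (Finset V)} {i : ℕ} {η : ℝ} {x y : Fin n}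
    (hi : 1 ≤ i) (hV : 1 ≤ Fintype.card V) (h : CloseTo E EF i η x y) :
    η * n ^ (Fintype.card V - 1) ≤
      ((powersetCard (Fintype.card V - 1) univ).filter fun Y : Finset (Fin n) =>
        x ∉ Y ∧ IsCopy E EF (insert x Y)).card := by
  have hn : 0 < n := x.pos
  obtain ⟨i, rfl⟩ := Nat.exists_eq_add_of_le' hi
  set v := Fintype.card V
  have hexp : (i + 1) * v - 1 = (v - 1) + i * v := by rw [Nat.succ_mul]; omega
  refine le_of_mul_le_mul_right ?_ (show (0 : ℝ) < (n : ℝ) ^ (i * v) by positivity)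
  rw [mul_assoc, ← pow_add, ← hexp]
  refine h.le_card.trans ?_
  norm_cast
  refine le_trans (card_le_card ?_) (le_trans (card_image_le (f := fun q => q.1 ∪ q.2)
    (s := ((powersetCard (v - 1) univ).filter fun Y : Finset (Fin n) =>
        x ∉ Y ∧ IsCopy E EF (insert x Y)) ×ˢ powersetCard (i * v) univ)) ?_)
  · intro S hS
    obtain ⟨-, hScard, hxS, -, ⟨P, hP, -, hPS⟩, -⟩ := mem_filter.1 hS
    have hx : x ∈ P.biUnion id := hPS ▸ mem_insert_self x S
    obtain ⟨A, hAP, hxA⟩ := mem_biUnion.1 hx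
    rw [id] at hxA
    have hAS : A.erase x ⊆ S := by
      rw [← erase_insert hxS, ← hPS]
      exact erase_subset_erase _ (subset_biUnion_of_mem id hAP)
    have hA : (A.erase x).card = v - 1 := by
      rw [card_erase_of_mem hxA, (hP A hAP).card_eq]
    refine mem_image.2 ⟨(A.erase x, S \ A.erase x), ?_, union_sdiff_of_subset hAS⟩
    simp only [mem_product, mem_filter, mem_powersetCard, subset_univ, true_and]
    refine ⟨⟨hA, notMem_erase x A, by rw [insert_erase hxA]; exact hP A hAP⟩, ?_⟩
    change S.card = (i + 1) * v - 1 at hScard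
    rw [card_sdiff_of_subset hAS, hA, hScard]
    omega
  · rw [card_product]
    exact Nat.mul_le_mul_left _ (card_powersetCard_fin_le _ _)

theorem exists_injective_image_eq {n r : ℕ} {Y : Finset (Fin n)} (h : Y.card = r) :
    ∃ f : Fin r → Fin n, Function.Injective f ∧ univ.image f = Y :=
  ⟨Y.orderEmbOfFin h, (Y.orderEmbOfFin h).injective, by
    apply coe_injective; simp⟩

/-- The pairs consisting of an `r`-set and a sequence of `r` further `b`-sets. -/
def absorberIndices (n r b : ℕ) : Finset (Finset (Fin n) × (Fin r → Finset (Fin n))) :=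
  powersetCard r univ ×ˢ Fintype.piFinset fun _ => powersetCard b univ

/-- The vertices occurring in a member of `absorberIndices`. -/
def absorberCarrier {n r : ℕ} (ω : Finset (Fin n) × (Fin r → Finset (Fin n))) :
    Finset (Fin n) :=
  ω.1 ∪ univ.biUnion ω.2

theorem card_absorberCarrier_le {n r b : ℕ} {ω : Finset (Fin n) × (Fin r → Finset (Fin n))}
    (h : ω ∈ absorberIndices n r b) : (absorberCarrier ω).card ≤ r * (b + 1) := by
  simp only [absorberIndices, mem_product, mem_powersetCard, Fintype.mem_piFinset, subset_univ,
    true_and] at h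
  calc (absorberCarrier ω).card ≤ ω.1.card + (univ.biUnion ω.2).card := card_union_le _ _
    _ ≤ r + r * b := by
      refine add_le_add h.1.le ?_
      simpa using card_biUnion_le_card_mul univ ω.2 b fun j _ => (h.2 j).le
    _ = r * (b + 1) := by ring

theorem absorberCarrier_nonempty {n r b : ℕ} (hr : 1 ≤ r)
    {ω : Finset (Fin n) × (Fin r → Finset (Fin n))} (h : ω ∈ absorberIndices n r b) :
    (absorberCarrier ω).Nonempty := by
  simp only [absorberIndices, mem_product, mem_powersetCard] at h
  exact (card_pos.1 (by omega : 0 < ω.1.card)).mono subset_union_left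

theorem card_absorberIndices_le (n r b : ℕ) :
    (b.factorial : ℝ) ^ r * (absorberIndices n r b).card ≤ n ^ (r * (b + 1)) := by
  have h1 : ((n.choose r : ℕ) : ℝ) ≤ n ^ r := by exact_mod_cast Nat.choose_le_pow n r
  have h2 : (b.factorial : ℝ) * n.choose b ≤ n ^ b := by
    have := Nat.choose_le_pow_div (α := ℝ) b n
    rwa [le_div_iff₀' (by positivity)] at this
  calc (b.factorial : ℝ) ^ r * (absorberIndices n r b).card
      = n.choose r * (b.factorial * n.choose b) ^ r := by
        simp [absorberIndices, Fintype.card_piFinset, mul_pow]; ring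
    _ ≤ n ^ r * (n ^ b) ^ r := by gcongr
    _ = n ^ (r * (b + 1)) := by rw [← pow_mul, ← pow_add]; congr 1; ring

theorem isAbsorber_of_systems {n r : ℕ} {V : Type} [Fintype V] [DecidableEq V]
    {E : Finset (Finset (Fin n))} {EF : Finset (Finset V)} {x : Fin n} {X Y : Finset (Fin n)}
    {f g : Fin r → Fin n} (hf : Function.Injective f) (hg : Function.Injective g)
    (hfX : univ.image f = X) (hgY : univ.image g = Y) {S : Fin r → Finset (Fin n)}
    (hxX : x ∉ X) (hYX : Disjoint Y (insert x X))
    (hS : ∀ j, Disjoint (S j) (insert x X ∪ Y))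
    (hSS : Pairwise fun j l => Disjoint (S j) (S l)) (hcopy : IsCopy E EF (insert x Y))
    (hSf : ∀ j, HasFactorOn E EF (insert (f j) (S j)))
    (hSg : ∀ j, HasFactorOn E EF (insert (g j) (S j))) :
    IsAbsorber E EF (insert x X) (absorberCarrier (Y, S)) := by
  have hfm : ∀ j, f j ∈ X := fun j => hfX ▸ mem_image_of_mem f (mem_univ j)
  have hgm : ∀ j, g j ∈ Y := fun j => hgY ▸ mem_image_of_mem g (mem_univ j)
  have hins : ∀ h : Fin r → Fin n, univ.biUnion (fun j => insert (h j) (S j)) =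
      univ.image h ∪ univ.biUnion S := by
    intro h; ext; simp [exists_or, eq_comm]
  have hdis : ∀ h : Fin r → Fin n, Function.Injective h → (∀ j, h j ∈ insert x X ∪ Y) →
      ((univ : Finset (Fin r)) : Set (Fin r)).PairwiseDisjoint
        fun j => insert (h j) (S j) := by
    intro h hh hm j _ l _ hjl
    simp only [Function.onFun, disjoint_insert_left, disjoint_insert_right, mem_insert, not_or]
    exact ⟨⟨fun e => hjl (hh e).symm, fun e => disjoint_left.1 (hS j) e (hm l)⟩,
      fun e => disjoint_left.1 (hS l) e (hm j), hSS hjl⟩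
  constructor
  · have := hasFactorOn_biUnion univ _ (hdis g hg fun j => mem_union_right _ (hgm j))
      fun j _ => hSg j
    rwa [hins, hgY] at this
  · have := hasFactorOn_biUnion univ _
      (hdis f hf fun j => mem_union_left _ (mem_insert_of_mem (hfm j))) fun j _ => hSf j
    rw [hins, hfX] at this
    have h2 := hcopy.hasFactorOn.union this (by
      rw [disjoint_union_right, disjoint_biUnion_right]
      refine ⟨?_, fun j _ => ((hS j).symm).mono_left ?_⟩
      · rw [disjoint_insert_left]
        exact ⟨hxX, hYX.mono_right (subset_insert _ _)⟩
      · exact insert_subset (by simp) subset_union_right)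
    convert h2 using 1
    ext; simp [absorberCarrier]; tauto

open Classical in
/-- In a closed hypergraph every `(r + 1)`-set has many absorbers avoiding a small set. -/
theorem IsClosedGraph.le_card_isAbsorber {n r b i : ℕ} {η : ℝ} {E : Finset (Finset (Fin n))}
    {EF : Finset (Finset (Fin (r + 1)))} (hcl : IsClosedGraph E EF i η) (hη : 0 ≤ η) (hi : 1 ≤ i)
    (hr : 1 ≤ r) (hb : i * (r + 1) = b + 1) (hb' : 1 ≤ b) (U T : Finset (Fin n))
    (hT : T.card = r + 1) (hU : (U.card : ℝ) + (r + 1 + r * (b + 1)) ≤ η / 2 * n) :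
    (η / 2) ^ (r + 1) * n ^ (r * (b + 1)) ≤ ((absorberIndices n r b).filter fun ω =>
      Disjoint (absorberCarrier ω) U ∧ IsAbsorber E EF T (absorberCarrier ω)).card := by
  obtain ⟨x, X, hxX, rfl, hX⟩ := card_eq_succ.1 hT
  obtain ⟨f, hf, hfX⟩ := exists_injective_image_eq hX
  have hfm : ∀ j, f j ∈ X := fun j => hfX ▸ mem_image_of_mem f (mem_univ j)
  have hrb : (0 : ℝ) ≤ r * b := by positivity
  have hZ : ((U ∪ insert x X).card : ℝ) ≤ U.card + (r + 1) := by
    have := card_union_le U (insert x X)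
    rw [hT] at this
    exact_mod_cast this
  have hpow : (η / 2) ^ (r + 1) * (n : ℝ) ^ (r * (b + 1)) =
      (η / 2 * n ^ r) * (η / 2 * n ^ b) ^ r := by
    rw [mul_pow, ← pow_mul]; ring
  rw [hpow]
  have hcopies := (hcl x (f ⟨0, hr⟩)
    fun h => hxX (h ▸ hfm _)).le_card_isCopy hi (by simp)
  simp only [Fintype.card_fin, Nat.add_sub_cancel] at hcopies
  have hYs := half_le_card_filter_disjoint hr _
    (fun S hS => (mem_powersetCard.1 (mem_filter.1 hS).1).2) hcopies (U ∪ insert x X)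
    (by nlinarith)
  have hex : ∀ Y : Finset (Fin n), ∃ g : Fin r → Fin n, Y.card = r →
      Function.Injective g ∧ univ.image g = Y := by
    intro Y
    by_cases hY : Y.card = r
    · obtain ⟨g, hg⟩ := exists_injective_image_eq hY
      exact ⟨g, fun _ => hg⟩
    · exact ⟨f, fun h => absurd h hY⟩
  choose g hg using hex
  let F (Y : Finset (Fin n)) (j : Fin r) : Finset (Finset (Fin n)) :=
    univ.filter fun S => S.card = b ∧ f j ∉ S ∧ g Y j ∉ S ∧
      HasFactorOn E EF (insert (f j) S) ∧ HasFactorOn E EF (insert (g Y j) S)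
  refine mul_le_card_of_injOn
    (B := fun Y => (Fintype.piFinset (F Y)).filter fun S =>
      (∀ j, Disjoint (S j) (U ∪ insert x X ∪ Y)) ∧ Pairwise fun j l => Disjoint (S j) (S l))
    Prod.mk (by positivity) hYs ?_ ?_ fun _ _ _ _ h => Prod.mk.inj h
  · intro Y hY
    simp only [mem_filter, mem_powersetCard, subset_univ, true_and, disjoint_union_right] at hY
    obtain ⟨⟨hYr, -, -⟩, hYU, hYX⟩ := hY
    refine pow_le_card_disjoint_systems hη hb' (F Y) (fun j S hS => (mem_filter.1 hS).2.1)
      (fun j => ?_) _ ?_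
    · have hne : f j ≠ g Y j := fun h => disjoint_left.1 hYX
        ((hg Y hYr).2 ▸ mem_image_of_mem _ (mem_univ j)) (h ▸ mem_insert_of_mem (hfm j))
      have := (hcl _ _ hne).le_card
      simpa only [Fintype.card_fin, hb, Nat.add_sub_cancel] using this
    · have : ((U ∪ insert x X ∪ Y).card : ℝ) ≤ (U ∪ insert x X).card + r := by
        rw [← hYr]; exact_mod_cast card_union_le _ _
      nlinarith
  · intro Y hY S hS
    simp only [mem_filter, mem_powersetCard, subset_univ, true_and, disjoint_union_right] at hY
    obtain ⟨⟨hYr, -, hcopy⟩, hYU, hYX⟩ := hY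
    simp only [mem_filter, Fintype.mem_piFinset, F, mem_univ, true_and] at hS
    obtain ⟨hSF, hSd, hSS⟩ := hS
    rw [mem_filter]
    refine ⟨by simp [absorberIndices, hYr, fun j => (hSF j).1], ?_, ?_⟩
    · simp only [absorberCarrier, disjoint_union_left, disjoint_biUnion_left]
      exact ⟨hYU, fun j _ => (hSd j).mono_right
        (subset_union_left.trans subset_union_left)⟩
    · refine isAbsorber_of_systems hf (hg Y hYr).1 hfX (hg Y hYr).2 hxX hYX (fun j =>
        (hSd j).mono_right (union_subset_union_left subset_union_right)) hSS hcopy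
        (fun j => (hSF j).2.2.2.1) fun j => (hSF j).2.2.2.2

open Classical in
/-- Greedy selection of disjoint sets driven by the potential `∑ T, (1 / 2) ^ (hits of T)`:
if every `T` is hit by a proportion `p` of the candidates avoiding any small set, then the
potential decays exponentially. -/
theorem exists_disjoint_family {n : ℕ} {τ ω : Type} (Ts : Finset τ) (hTs : Ts.Nonempty)
    (Ω : Finset ω) (hΩ : Ω.Nonempty) (g : ω → Finset (Fin n)) (R : τ → Finset (Fin n) → Prop)
    (m M : ℕ) {p : ℝ} (hp : 0 < p) (hm : ∀ a ∈ Ω, (g a).card ≤ m) (hne : ∀ a ∈ Ω, (g a).Nonempty)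
    (h : ∀ U : Finset (Fin n), U.card ≤ M * m → ∀ T ∈ Ts,
      p * Ω.card ≤ (Ω.filter fun a => Disjoint (g a) U ∧ R T (g a)).card)
    (s : ℕ) (hs : s ≤ M) :
    ∃ G : Finset (Finset (Fin n)), (G : Set (Finset (Fin n))).PairwiseDisjoint id ∧
      (∀ A ∈ G, ∃ T ∈ Ts, R T A) ∧ (G.biUnion id).card ≤ s * m ∧
      ∑ T ∈ Ts, (1 / 2 : ℝ) ^ (G.filter (R T)).card ≤ Ts.card * Real.exp (-(p / 2) * s) := by
  induction s with
  | zero => exact ⟨∅, by simp, by simp, by simp, by simp⟩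
  | succ s ih =>
    obtain ⟨G, hGd, hGR, hGcard, hGpot⟩ := ih (by omega)
    set U := G.biUnion id with hUdef
    set w : τ → ℝ := fun T => (1 / 2 : ℝ) ^ (G.filter (R T)).card with hw
    set Φ := ∑ T ∈ Ts, w T with hΦ
    have hΦpos : 0 < Φ := sum_pos (fun T _ => by positivity) hTs
    have hU : U.card ≤ M * m := hGcard.trans (Nat.mul_le_mul_right _ (by omega))
    obtain ⟨a, ha, hgain⟩ : ∃ a ∈ Ω, p * Φ ≤
        ∑ T ∈ Ts, if Disjoint (g a) U ∧ R T (g a) then w T else 0 := by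
      refine exists_le_of_sum_le hΩ ?_
      rw [sum_comm, sum_const, nsmul_eq_mul, hΦ, mul_sum, mul_sum]
      refine sum_le_sum fun T hT => ?_
      rw [← sum_filter, sum_const, nsmul_eq_mul]
      have := mul_le_mul_of_nonneg_right (h U hU T hT) (show 0 ≤ w T by positivity)
      linarith
    obtain ⟨T₀, hT₀, hne₀⟩ := exists_ne_zero_of_sum_ne_zero
      (lt_of_lt_of_le (mul_pos hp hΦpos) hgain).ne'
    obtain ⟨hdisj, hR₀⟩ : Disjoint (g a) U ∧ R T₀ (g a) := by
      by_contra hcon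
      exact hne₀ (if_neg hcon)
    simp only [hdisj, true_and] at hgain
    have hnot : g a ∉ G := fun hmem => (hne a ha).ne_empty
      (disjoint_self.1 (hdisj.mono_right (subset_biUnion_of_mem id hmem)))
    refine ⟨insert (g a) G, ?_, ?_, ?_, ?_⟩
    · rw [coe_insert, Set.pairwiseDisjoint_insert]
      exact ⟨hGd, fun A hA _ => hdisj.mono_right (subset_biUnion_of_mem id hA)⟩
    · rw [forall_mem_insert]
      exact ⟨⟨T₀, hT₀, hR₀⟩, hGR⟩
    · rw [biUnion_insert]
      refine (card_union_le _ _).trans ?_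
      rw [Nat.succ_mul, add_comm]
      exact add_le_add hGcard (hm a ha)
    · have hstep : ∀ T, (1 / 2 : ℝ) ^ ((insert (g a) G).filter (R T)).card =
          w T - (if R T (g a) then w T else 0) / 2 := by
        intro T
        rw [filter_insert]
        split_ifs with hRT
        · rw [card_insert_of_notMem (by simp [hnot]), pow_succ]
          simp only [hw]
          ring
        · simp [hw]
      calc ∑ T ∈ Ts, (1 / 2 : ℝ) ^ ((insert (g a) G).filter (R T)).card
          = Φ - (∑ T ∈ Ts, if R T (g a) then w T else 0) / 2 := by
            rw [sum_congr rfl fun T _ => hstep T, sum_sub_distrib, sum_div]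
        _ ≤ Φ * (-(p / 2) + 1) := by linarith
        _ ≤ Φ * Real.exp (-(p / 2)) := by
            gcongr
            exact Real.add_one_le_exp _
        _ ≤ Ts.card * Real.exp (-(p / 2) * s) * Real.exp (-(p / 2)) := by gcongr
        _ = Ts.card * Real.exp (-(p / 2) * (s + 1 : ℕ)) := by
            rw [mul_assoc, ← Real.exp_add]
            push_cast
            ring_nf

theorem mul_succ_le_two_mul_factorial_pow {r b : ℕ} (hr : 1 ≤ r) (hrb : r ≤ b) :
    r * (b + 1) ≤ 2 * b.factorial ^ r := by
  have h1 : b + 1 ≤ 2 * b.factorial := by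
    have := Nat.self_le_factorial b
    have := Nat.factorial_pos b
    omega
  have h2 : r ≤ b.factorial ^ (r - 1) := by
    rcases hr.eq_or_lt with rfl | hr
    · simp
    · have : 2 ≤ b.factorial := (by omega : 2 ≤ b).trans (Nat.self_le_factorial b)
      have h3 : r - 1 < 2 ^ (r - 1) := Nat.lt_two_pow_self
      have := Nat.pow_le_pow_left this (r - 1)
      omega
  calc r * (b + 1) ≤ b.factorial ^ (r - 1) * (2 * b.factorial) := Nat.mul_le_mul h2 h1
    _ = 2 * b.factorial ^ (r - 1 + 1) := by rw [pow_succ]; ring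
    _ = 2 * b.factorial ^ r := by rw [Nat.sub_add_cancel hr]

open Filter in
theorem eventually_pow_mul_exp_lt (t : ℕ) {c d : ℝ} (hd : 0 < d) :
    ∀ᶠ n : ℕ in atTop, (n : ℝ) ^ t * Real.exp c < Real.exp (d * n) := by
  have h := (isLittleO_pow_exp_pos_mul_atTop t hd).comp_tendsto tendsto_natCast_atTop_atTop
  have h' := h.bound (show 0 < Real.exp (-c) / 2 by positivity)
  filter_upwards [h'] with n hn
  simp only [Function.comp, norm_pow, Real.norm_eq_abs, Nat.abs_cast, Real.abs_exp] at hn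
  have hc : Real.exp (-c) * Real.exp c = 1 := by rw [← Real.exp_add]; simp
  have := mul_le_mul_of_nonneg_right hn (Real.exp_pos c).le
  have hpos := Real.exp_pos (d * n)
  calc (n : ℝ) ^ t * Real.exp c ≤ Real.exp (-c) / 2 * Real.exp (d * n) * Real.exp c := this
    _ = (Real.exp (-c) * Real.exp c) * Real.exp (d * n) / 2 := by ring
    _ < Real.exp (d * n) := by rw [hc]; linarith

open Classical in
/-- A closed hypergraph has a small family of disjoint absorbers in which every `t`-set is
absorbed by many members. -/
theorem IsClosedGraph.exists_absorbing_family {n r b i : ℕ} {η : ℝ}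
    {E : Finset (Finset (Fin n))} {EF : Finset (Finset (Fin (r + 1)))}
    (hcl : IsClosedGraph E EF i η) (hη : 0 < η) (hi : 1 ≤ i) (hr : 1 ≤ r)
    (hb : i * (r + 1) = b + 1) (hn2 : 2 ≤ n) (hnr : r + 1 ≤ n)
    (hn : (r + 1 + r * (b + 1) : ℝ) ≤ η / 4 * n)
    (hexp : (n : ℝ) ^ (r + 1) * Real.exp ((η / 2) ^ (r + 1) * b.factorial ^ r / 2) <
      Real.exp (((η / 2) ^ (r + 1)) ^ 2 / 32 * n)) :
    ∃ G : Finset (Finset (Fin n)), (G : Set (Finset (Fin n))).PairwiseDisjoint id ∧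
      (∀ A ∈ G, HasFactorOn E EF A) ∧
      ((G.biUnion id).card : ℝ) ≤ (η / 2) ^ (r + 1) * n / 4 ∧
      ∀ T : Finset (Fin n), T.card = r + 1 →
        ((η / 2) ^ (r + 1)) ^ 2 / 32 * n ≤ ((G.filter (IsAbsorber E EF T)).card : ℝ) := by
  have hη1 : η ≤ 1 := (hcl ⟨0, by omega⟩ ⟨1, by omega⟩ (by simp)).le_one
  have hrb : r ≤ b := by nlinarith
  have hκη : (η / 2) ^ (r + 1) ≤ η / 2 :=
    pow_le_of_le_one (by positivity) (by linarith) (by omega)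
  set κ := (η / 2) ^ (r + 1) with hκdef
  have hκ : 0 < κ := by positivity
  set q : ℝ := (b.factorial : ℝ) ^ r with hq
  have hq0 : 0 < q := by positivity
  set m := r * (b + 1) with hmdef
  have hm0 : 0 < m := by positivity
  have hmR : (0 : ℝ) < m := by exact_mod_cast hm0
  have hmq : (m : ℝ) ≤ 2 * q := by
    have := mul_succ_le_two_mul_factorial_pow hr hrb
    rw [hq]; exact_mod_cast this
  have hm' : (r * (b + 1) : ℝ) = m := by rw [hmdef]; push_cast; ring
  have hn0 : (0 : ℝ) < n := by exact_mod_cast (by omega : 0 < n)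
  set M := ⌊κ * n / (4 * m)⌋₊ with hM
  have hMm : (M * m : ℝ) ≤ κ * n / 4 := by
    have := Nat.floor_le (show 0 ≤ κ * n / (4 * m) by positivity)
    calc (M * m : ℝ) ≤ κ * n / (4 * m) * m := by gcongr
      _ = κ * n / 4 := by field_simp
  have hcount : ∀ U : Finset (Fin n), U.card ≤ M * m → ∀ T : Finset (Fin n), T.card = r + 1 →
      κ * n ^ m ≤ ((absorberIndices n r b).filter fun ω =>
        Disjoint (absorberCarrier ω) U ∧ IsAbsorber E EF T (absorberCarrier ω)).card := by
    intro U hU T hT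
    have hU' : (U.card : ℝ) ≤ M * m := by exact_mod_cast hU
    exact hcl.le_card_isAbsorber hη.le hi hr hb (hr.trans hrb) U T hT (by nlinarith)
  obtain ⟨T₀, hT₀⟩ : (powersetCard (r + 1) (univ : Finset (Fin n))).Nonempty :=
    powersetCard_nonempty.2 (by simpa using hnr)
  have hΩ : (absorberIndices n r b).Nonempty := by
    have h1 := hcount ∅ (by simp) T₀ (mem_powersetCard.1 hT₀).2
    have h2 : 0 < κ * (n : ℝ) ^ m := by positivity
    have h3 := lt_of_lt_of_le h2 h1
    exact (card_pos.1 (by exact_mod_cast h3)).mono (filter_subset _ _)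
  obtain ⟨G, hGd, hGR, hGcard, hGpot⟩ := exists_disjoint_family
    (powersetCard (r + 1) (univ : Finset (Fin n))) ⟨T₀, hT₀⟩ (absorberIndices n r b) hΩ
    absorberCarrier (IsAbsorber E EF) m M (show 0 < κ * q by positivity)
    (fun _ => card_absorberCarrier_le) (fun _ => absorberCarrier_nonempty hr)
    (fun U hU T hT => by
      refine le_trans ?_ (hcount U hU T (mem_powersetCard.1 hT).2)
      rw [mul_assoc]
      exact mul_le_mul_of_nonneg_left (card_absorberIndices_le n r b) hκ.le) M le_rfl
  refine ⟨G, hGd, fun A hA => (hGR A hA).elim fun T hT => hT.2.1,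
    le_trans (by exact_mod_cast hGcard) hMm, fun T hT => ?_⟩
  have hpot : (1 / 2 : ℝ) ^ (G.filter (IsAbsorber E EF T)).card < Real.exp (-(κ ^ 2 / 32 * n)) := by
    have hMexp : -(κ * q / 2) * M ≤ κ * q / 2 + 2 * -(κ ^ 2 / 32 * n) := by
      have h1 := (Nat.lt_floor_add_one (κ * n / (4 * m))).le
      rw [div_le_iff₀ (by positivity)] at h1
      have h2 : κ * n ≤ (M + 1) * (8 * q) :=
        h1.trans (mul_le_mul_of_nonneg_left (by linarith) (by positivity))
      nlinarith
    have hTs : ((powersetCard (r + 1) (univ : Finset (Fin n))).card : ℝ) ≤ n ^ (r + 1) := by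
      exact_mod_cast card_powersetCard_fin_le n (r + 1)
    calc (1 / 2 : ℝ) ^ (G.filter (IsAbsorber E EF T)).card
        ≤ ∑ T ∈ powersetCard (r + 1) univ, (1 / 2 : ℝ) ^ (G.filter (IsAbsorber E EF T)).card :=
          single_le_sum (f := fun T => (1 / 2 : ℝ) ^ (G.filter (IsAbsorber E EF T)).card)
            (fun _ _ => by positivity) (mem_powersetCard.2 ⟨subset_univ T, hT⟩)
      _ ≤ n ^ (r + 1) * Real.exp (κ * q / 2 + 2 * -(κ ^ 2 / 32 * n)) := by
          refine hGpot.trans ?_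
          gcongr
      _ = n ^ (r + 1) * Real.exp (κ * q / 2) * Real.exp (-(κ ^ 2 / 32 * n)) *
            Real.exp (-(κ ^ 2 / 32 * n)) := by
          rw [two_mul, Real.exp_add, Real.exp_add]; ring
      _ < Real.exp (κ ^ 2 / 32 * n) * Real.exp (-(κ ^ 2 / 32 * n)) *
            Real.exp (-(κ ^ 2 / 32 * n)) := by gcongr
      _ = Real.exp (-(κ ^ 2 / 32 * n)) := by
          rw [← Real.exp_add, add_neg_cancel, Real.exp_zero, one_mul]
  have hhalf : Real.exp (-1) ≤ 1 / 2 := by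
    have := Real.exp_one_gt_d9
    rw [Real.exp_neg, inv_le_comm₀ (Real.exp_pos 1) (by norm_num)]
    norm_num; linarith
  have hlow : Real.exp (-((G.filter (IsAbsorber E EF T)).card : ℝ)) ≤
      (1 / 2 : ℝ) ^ (G.filter (IsAbsorber E EF T)).card := by
    rw [← mul_neg_one, Real.exp_nat_mul]
    exact pow_le_pow_left₀ (Real.exp_pos _).le hhalf _
  have := Real.exp_lt_exp.1 (hlow.trans_lt hpot)
  linarith

theorem hasFactorOn_of_singleton {n : ℕ} (E : Finset (Finset (Fin n)))
    (W : Finset (Fin n)) : HasFactorOn E (∅ : Finset (Finset (Fin 1))) W := by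
  have := hasFactorOn_biUnion (E := E) (EF := (∅ : Finset (Finset (Fin 1)))) W
    (fun x => {x}) (fun x _ y _ hxy => by simpa [Function.onFun] using hxy)
    fun x _ => IsCopy.hasFactorOn ⟨⟨fun _ => x, fun _ _ _ => Subsingleton.elim _ _⟩, rfl,
      by simp⟩
  rwa [biUnion_singleton_eq_self] at this

/-- Absorption lemma for `F`-factors. -/
theorem absorption_lemma_for_F_factors (k t i : ℕ) (η : ℝ)
    (hk : 2 ≤ k) (ht : 1 ≤ t) (hi : 1 ≤ i) (hη : 0 < η) :
    ∃ n₀ : ℕ, ∀ n : ℕ, n₀ ≤ n →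
      ∀ EF : Finset (Finset (Fin t)), (∀ e ∈ EF, e.card = k) →
      ∀ E : Finset (Finset (Fin n)), (∀ e ∈ E, e.card = k) →
      IsClosedGraph E EF i η →
      ∃ U : Finset (Fin n), (U.card : ℝ) ≤ (η / 2) ^ t * n / 4 ∧
        ∀ W : Finset (Fin n), Disjoint W U →
          (W.card : ℝ) ≤ (η / 2) ^ (2 * t) * t * n / 32 → t ∣ W.card →
          HasFactorOn E EF (U ∪ W) := by
  obtain ⟨r, rfl⟩ := Nat.exists_eq_add_of_le' ht
  rcases Nat.eq_zero_or_pos r with rfl | hr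
  · refine ⟨0, fun n _ EF hEF E _ _ => ⟨∅, by simpa using by positivity, fun W _ _ _ => ?_⟩⟩
    obtain rfl : EF = ∅ := by
      refine eq_empty_of_forall_notMem fun e he => ?_
      have h1 := hEF e he
      have h2 := card_le_univ e
      simp at h2
      omega
    exact hasFactorOn_of_singleton E _
  obtain ⟨b, hb⟩ : ∃ b, i * (r + 1) = b + 1 :=
    Nat.exists_eq_add_of_le' (Nat.mul_pos hi r.succ_pos)
  have hlin : ∀ᶠ n : ℕ in Filter.atTop, (r + 1 + r * (b + 1) : ℝ) ≤ η / 4 * n :=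
    (tendsto_natCast_atTop_atTop.const_mul_atTop (by positivity)).eventually_ge_atTop _
  obtain ⟨n₀, hn₀⟩ := Filter.eventually_atTop.1 (((hlin.and (eventually_pow_mul_exp_lt (r + 1)
    (c := (η / 2) ^ (r + 1) * b.factorial ^ r / 2)
    (d := ((η / 2) ^ (r + 1)) ^ 2 / 32) (by positivity))).and
    (Filter.eventually_ge_atTop (r + 1))))
  refine ⟨n₀, fun n hn EF _ E _ hcl => ?_⟩
  obtain ⟨⟨h1, h2⟩, h3⟩ := hn₀ n hn
  obtain ⟨G, hGd, hGf, hGcard, hG⟩ :=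
    hcl.exists_absorbing_family hη hi hr hb (by omega) h3 h1 h2
  refine ⟨G.biUnion id, hGcard, fun W hW hWcard hdvd => ?_⟩
  obtain ⟨s, hs⟩ := hdvd
  rw [mul_comm] at hs
  refine hasFactorOn_biUnion_union s G W hGd hGf hW hs fun T hT => ?_
  have hT := hG T hT
  rw [hs, mul_comm 2, pow_mul] at hWcard
  have hs' : (s : ℝ) ≤ ((η / 2) ^ (r + 1)) ^ 2 / 32 * n := by
    have h0 : (0 : ℝ) < ((r + 1 : ℕ) : ℝ) := by positivity
    refine le_of_mul_le_mul_right ?_ h0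
    push_cast at hWcard ⊢
    linarith
  exact_mod_cast hs'.trans hT
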